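/- For every A ≥ 1 there exist constants C > 0 and τ₀ ∈ (0,1), depending only on A, such that for all τ ∈ (0, τ₀), every P ∈ S³, and every t with A⁻¹ τ^{−1/2} < t < A τ^{−1/2}, one has ‖ δ_{P,t}^{2−τ} − δ_{P,t}² ‖_{L^{3/2}(S³)} ≤ C τ |log τ| and ‖ δ_{P,t}^{1−τ} − δ_{P,t} ‖_{L³(S³)} ≤ C τ |log τ|, where the L^p norms are taken with respect to the surface measure of S³. -/

import Mathlib

open MeasureTheory Real Set Metric
open scoped RealInnerProductSpace

noncomputable section

/-- The unit sphere `S³ ⊂ ℝ⁴`. -/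
abbrev S3 : Set (EuclideanSpace ℝ (Fin 4)) := Metric.sphere (0 : EuclideanSpace ℝ (Fin 4)) 1

/-- The surface (Riemannian volume) measure on `S³`, realized as the measure on the unit
sphere induced by the Lebesgue measure of `ℝ⁴` (so that the total mass is `2π²`). -/
def μS3 : Measure S3 := (volume : Measure (EuclideanSpace ℝ (Fin 4))).toSphere

/-- The standard bubble `δ_{P,t}(x) = t / (1 + ((t²−1)/2)(1 − ⟨x,P⟩))` on `S³`. -/
def bubble (P : S3) (t : ℝ) (x : S3) : ℝ :=
  t / (1 + ((t ^ 2 - 1) / 2) *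
    (1 - ⟪(x : EuclideanSpace ℝ (Fin 4)), (P : EuclideanSpace ℝ (Fin 4))⟫))

/-- The geodesic distance on the unit sphere: `d(P,Q) = arccos ⟨P,Q⟩`. -/
def geoDist (P Q : S3) : ℝ :=
  Real.arccos ⟪(P : EuclideanSpace ℝ (Fin 4)), (Q : EuclideanSpace ℝ (Fin 4))⟫

/-- The Green's function `G_P(Q) = 1/(1 − ⟨P,Q⟩) = 1/(1 − cos d(P,Q))`. -/
def green (P Q : S3) : ℝ :=
  1 / (1 - ⟪(P : EuclideanSpace ℝ (Fin 4)), (Q : EuclideanSpace ℝ (Fin 4))⟫)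

open scoped Pointwise in
/-- The surface measure of a spherical cap of radius `r` in an `(n + 1)`-dimensional space is
`O(r ^ n)`. -/
theorem toSphere_real_closedBall_le {E : Type*} [NormedAddCommGroup E] [NormedSpace ℝ E]
    [FiniteDimensional ℝ E] [MeasurableSpace E] [BorelSpace E] (μ : Measure E)
    [μ.IsAddHaarMeasure] {n : ℕ} (hn : Module.finrank ℝ E = n + 1)
    (P : sphere (0 : E) 1) {r : ℝ} (hr : 0 < r) :
    μ.toSphere.real (closedBall P r) ≤ (n + 1) * 2 ^ (n + 2) * μ.real (ball 0 1) * r ^ n := by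
  have : Nontrivial E := Module.nontrivial_of_finrank_pos (R := ℝ) (by omega)
  rcases le_or_gt r 1 with hr1 | hr1
  · have hcover : Ioo (0 : ℝ) 1 • ((↑) '' closedBall P r : Set E) ⊆
        ⋃ k ∈ Finset.range (⌊1 / r⌋₊ + 1), ball (((k : ℝ) * r) • (P : E)) (2 * r) := by
      rintro _ ⟨s, ⟨hs0, hs1⟩, _, ⟨x, hx, rfl⟩, rfl⟩
      have hfl := Nat.floor_le (div_nonneg hs0.le hr.le)
      have hfl' := Nat.lt_floor_add_one (s / r)
      rw [le_div_iff₀ hr] at hfl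
      rw [div_lt_iff₀ hr] at hfl'
      refine mem_iUnion₂.2 ⟨⌊s / r⌋₊, Finset.mem_range.2 (Nat.lt_succ_of_le
        (Nat.floor_mono (by gcongr))), ?_⟩
      have hP : ‖(P : E)‖ = 1 := by simp
      have hx' : ‖(x : E) - P‖ ≤ r := by rw [← dist_eq_norm]; exact hx
      rw [mem_ball, dist_eq_norm]
      calc ‖s • (x : E) - ((⌊s / r⌋₊ : ℝ) * r) • (P : E)‖
          = ‖s • ((x : E) - P) + (s - ⌊s / r⌋₊ * r) • (P : E)‖ := by
            congr 1; module
        _ ≤ ‖s • ((x : E) - P)‖ + ‖(s - ⌊s / r⌋₊ * r) • (P : E)‖ := norm_add_le _ _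
        _ = s * ‖(x : E) - P‖ + (s - ⌊s / r⌋₊ * r) := by
            rw [norm_smul, norm_smul, hP, Real.norm_of_nonneg hs0.le,
              Real.norm_of_nonneg (by linarith), mul_one]
        _ < 2 * r := by nlinarith [norm_nonneg ((x : E) - P)]
    have hball (y : E) : μ.real (ball y (2 * r)) = (2 * r) ^ (n + 1) * μ.real (ball 0 1) := by
      rw [measureReal_def, Measure.addHaar_ball _ _ (by positivity), hn, ENNReal.toReal_mul,
        ENNReal.toReal_ofReal (by positivity), measureReal_def]
    have hcone : μ.real (Ioo (0 : ℝ) 1 • ((↑) '' closedBall P r : Set E)) ≤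
        (⌊1 / r⌋₊ + 1) * ((2 * r) ^ (n + 1) * μ.real (ball 0 1)) := by
      calc _ ≤ μ.real (⋃ k ∈ Finset.range (⌊1 / r⌋₊ + 1),
            ball (((k : ℝ) * r) • (P : E)) (2 * r)) :=
            measureReal_mono hcover ((measure_biUnion_lt_top (Finset.finite_toSet _)
              fun _ _ ↦ measure_ball_lt_top).ne)
        _ ≤ ∑ k ∈ Finset.range (⌊1 / r⌋₊ + 1), μ.real (ball (((k : ℝ) * r) • (P : E)) (2 * r)) :=
            measureReal_biUnion_finset_le _ _
        _ = _ := by simp [hball]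
    have hfl : (⌊1 / r⌋₊ : ℝ) + 1 ≤ 2 / r := by
      have h1 := Nat.floor_le (one_div_pos.2 hr).le
      have h2 : 1 ≤ 1 / r := by rwa [le_div_iff₀ hr, one_mul]
      calc (⌊1 / r⌋₊ : ℝ) + 1 ≤ 1 / r + 1 / r := by gcongr
        _ = 2 / r := by ring
    rw [measureReal_def, Measure.toSphere_apply' _ isClosed_closedBall.measurableSet, hn,
      ENNReal.toReal_mul, ← measureReal_def, ENNReal.toReal_natCast]
    push_cast
    calc _ ≤ ((n : ℝ) + 1) * (2 / r * ((2 * r) ^ (n + 1) * μ.real (ball 0 1))) := by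
          gcongr; exact hcone.trans (by gcongr)
      _ = _ := by field_simp; ring
  · calc μ.toSphere.real (closedBall P r) ≤ μ.toSphere.real univ :=
          measureReal_mono (subset_univ _)
      _ = (n + 1) * 1 * μ.real (ball 0 1) * 1 := by
          rw [Measure.toSphere_real_apply_univ, hn]; push_cast; ring
      _ ≤ _ := by
          gcongr
          · exact one_le_pow₀ (by norm_num)
          · exact one_le_pow₀ hr1.le

instance : IsFiniteMeasure μS3 := by unfold μS3; infer_instance

theorem real_inner_S3_eq (P x : S3) :
    ⟪(x : EuclideanSpace ℝ (Fin 4)), (P : EuclideanSpace ℝ (Fin 4))⟫ = 1 - dist x P ^ 2 / 2 := by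
  have h := norm_sub_sq_real (x : EuclideanSpace ℝ (Fin 4)) P
  rw [norm_eq_of_mem_sphere, norm_eq_of_mem_sphere] at h
  rw [Subtype.dist_eq, dist_eq_norm]
  linarith

theorem bubble_eq_dist (P : S3) (t : ℝ) (x : S3) :
    bubble P t x = t / (1 + (t ^ 2 - 1) / 4 * dist x P ^ 2) := by
  rw [bubble, real_inner_S3_eq]
  ring_nf

theorem one_le_bubble_denom {t : ℝ} (ht : 1 ≤ t) (d : ℝ) :
    1 ≤ 1 + (t ^ 2 - 1) / 4 * d ^ 2 := by
  have : 0 ≤ t ^ 2 - 1 := by nlinarith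
  have : 0 ≤ (t ^ 2 - 1) / 4 * d ^ 2 := by positivity
  linarith

theorem bubble_le {t : ℝ} (ht : 1 ≤ t) (P x : S3) : bubble P t x ≤ t := by
  rw [bubble_eq_dist]
  exact div_le_self (by linarith) (one_le_bubble_denom ht _)

theorem inv_le_bubble {t : ℝ} (ht : 1 ≤ t) (P x : S3) : t⁻¹ ≤ bubble P t x := by
  have hd : dist x P ≤ 2 := by
    calc dist x P ≤ ‖(x : EuclideanSpace ℝ (Fin 4))‖ + ‖(P : EuclideanSpace ℝ (Fin 4))‖ := by
          rw [Subtype.dist_eq, dist_eq_norm]; exact norm_sub_le _ _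
      _ = 2 := by rw [norm_eq_of_mem_sphere, norm_eq_of_mem_sphere]; norm_num
  have hd2 : dist x P ^ 2 ≤ 4 := by nlinarith [dist_nonneg (x := x) (y := P)]
  have := one_le_bubble_denom ht (dist x P)
  rw [bubble_eq_dist, le_div_iff₀ (by linarith), inv_mul_le_iff₀ (by linarith)]
  have ht2 : 0 ≤ t ^ 2 - 1 := by nlinarith
  nlinarith [mul_le_mul_of_nonneg_left hd2 ht2]

theorem bubble_pos {t : ℝ} (ht : 1 ≤ t) (P x : S3) : 0 < bubble P t x :=
  (inv_pos.2 (by linarith)).trans_le (inv_le_bubble ht P x)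

theorem bubble_mul_dist_sq_le {t : ℝ} (ht : 1 ≤ t) (ht2 : 2 ≤ t ^ 2) (P x : S3) :
    bubble P t x * (t * dist x P ^ 2) ≤ 8 := by
  have := one_le_bubble_denom ht (dist x P)
  rw [bubble_eq_dist, div_mul_eq_mul_div, div_le_iff₀ (by linarith)]
  nlinarith [sq_nonneg (dist x P)]

theorem continuous_bubble {t : ℝ} (ht : 1 ≤ t) (P : S3) : Continuous (bubble P t) := by
  simp_rw [funext (bubble_eq_dist P t)]
  refine Continuous.div (by fun_prop) (by fun_prop) fun x ↦ ?_
  have := one_le_bubble_denom ht (dist x P)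
  linarith

theorem integrable_bubble_pow {t : ℝ} (ht : 1 ≤ t) (P : S3) (n : ℕ) :
    Integrable (fun x ↦ bubble P t x ^ n) μS3 :=
  (continuous_bubble ht P).pow n |>.integrable_of_hasCompactSupport
    (HasCompactSupport.of_compactSpace _)

/-- The `L³` norm of the bubbles is bounded independently of the centre and of the scale. -/
theorem exists_integral_bubble_cube_le :
    ∃ K : ℝ, 1 ≤ K ∧ ∀ t : ℝ, 1 ≤ t → 2 ≤ t ^ 2 → ∀ P : S3, ∫ x, bubble P t x ^ 3 ∂μS3 ≤ K := by
  obtain ⟨K, hK0, hK⟩ : ∃ K : ℝ, 0 ≤ K ∧ ∀ (P : S3) (r : ℝ), 0 < r →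
      μS3.real (closedBall P r) ≤ K * r ^ 3 :=
    ⟨_, by positivity, fun P r hr ↦ toSphere_real_closedBall_le
      (volume : Measure (EuclideanSpace ℝ (Fin 4))) (n := 3) (by simp) P hr⟩
  refine ⟨max 1 (K * (512 ^ (1 / 2 : ℝ) * 2)), le_max_left _ _,
    fun t ht ht2 P ↦ le_max_of_le_right ?_⟩
  have ht0 : 0 < t := by linarith
  have hlevel (s : ℝ) (hs : 0 < s) : μS3.real {x | s ≤ bubble P t x ^ 3} ≤
      K * (512 / t ^ 3) ^ (1 / 2 : ℝ) * s ^ (-(1 / 2) : ℝ) := by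
    set q : ℝ := 512 / t ^ 3 / s with hq
    have hq0 : 0 < q := by positivity
    have hsub : {x | s ≤ bubble P t x ^ 3} ⊆ closedBall P (q ^ (1 / 6 : ℝ)) := by
      intro x hx
      have h6 : (q ^ (1 / 6 : ℝ)) ^ 6 = q := by
        rw [← Real.rpow_natCast, ← Real.rpow_mul hq0.le]; norm_num
      rw [mem_closedBall]
      refine le_of_pow_le_pow_left₀ (n := 6) (by norm_num) (by positivity) ?_
      rw [h6, hq, le_div_iff₀ hs, le_div_iff₀ (by positivity)]
      have hb := bubble_pos ht P x
      calc dist x P ^ 6 * s * t ^ 3 ≤ dist x P ^ 6 * bubble P t x ^ 3 * t ^ 3 := by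
            gcongr; exact hx
        _ = (bubble P t x * (t * dist x P ^ 2)) ^ 3 := by ring
        _ ≤ 8 ^ 3 := by gcongr; exact bubble_mul_dist_sq_le ht ht2 P x
        _ = 512 := by norm_num
    calc _ ≤ μS3.real (closedBall P (q ^ (1 / 6 : ℝ))) := measureReal_mono hsub
      _ ≤ K * (q ^ (1 / 6 : ℝ)) ^ 3 := hK P _ (by positivity)
      _ = K * q ^ (1 / 2 : ℝ) := by
          rw [← Real.rpow_natCast, ← Real.rpow_mul hq0.le]; norm_num
      _ = _ := by
          rw [hq, Real.div_rpow (by positivity) hs.le, Real.rpow_neg hs.le]; ring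
  have hint : IntervalIntegrable (fun s : ℝ ↦ s ^ (-(1 / 2) : ℝ)) volume 0 (t ^ 3) :=
    intervalIntegral.intervalIntegrable_rpow' (by norm_num)
  rw [(integrable_bubble_pow ht P 3).integral_eq_integral_Ioc_meas_le (M := t ^ 3)
    (.of_forall fun x ↦ pow_nonneg (bubble_pos ht P x).le 3)
    (.of_forall fun x ↦ pow_le_pow_left₀ (bubble_pos ht P x).le (bubble_le ht P x) 3)]
  calc _ ≤ ∫ s in Ioc 0 (t ^ 3), K * (512 / t ^ 3) ^ (1 / 2 : ℝ) * s ^ (-(1 / 2) : ℝ) := by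
        refine integral_mono_of_nonneg (.of_forall fun _ ↦ measureReal_nonneg) ?_ ?_
        · exact ((intervalIntegrable_iff_integrableOn_Ioc_of_le (by positivity)).1 hint).const_mul _
        · exact (ae_restrict_iff' measurableSet_Ioc).2 (.of_forall fun s hs ↦ hlevel s hs.1)
    _ = K * ((512 / t ^ 3) ^ (1 / 2 : ℝ) * (t ^ 3) ^ (1 / 2 : ℝ) * 2) := by
        rw [integral_const_mul, ← intervalIntegral.integral_of_le (by positivity),
          integral_rpow (.inl (by norm_num))]
        norm_num [mul_assoc]
        exact .inl (.inl (by ring))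
    _ = K * (512 ^ (1 / 2 : ℝ) * 2) := by
        rw [← Real.mul_rpow (by positivity) (by positivity), div_mul_cancel₀ _ (by positivity)]

theorem abs_rpow_sub_rpow_le {b τ L : ℝ} (hb : 0 < b) (hτ : 0 ≤ τ) (hlog : |Real.log b| ≤ L)
    (hL : τ * L ≤ 1) (p : ℝ) : |b ^ (p - τ) - b ^ p| ≤ 2 * (τ * L) * b ^ p := by
  have hx : |Real.log b * -τ| ≤ τ * L := by
    rw [abs_mul, abs_neg, abs_of_nonneg hτ, mul_comm]; gcongr
  have hbp := Real.rpow_pos_of_pos hb p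
  have heq : b ^ (p - τ) - b ^ p = b ^ p * (Real.exp (Real.log b * -τ) - 1) := by
    rw [← Real.rpow_def_of_pos hb, sub_eq_add_neg p, Real.rpow_add hb]; ring
  rw [heq, abs_mul, abs_of_pos hbp, mul_comm]
  gcongr
  exact (Real.abs_exp_sub_one_le (hx.trans hL)).trans (by gcongr)

/-- If `|f| ≤ c * g ^ p` pointwise with `p * q = 3`, then `‖f‖_{L^q} ≤ c * max 1 (∫ g ^ 3)`. -/
theorem integral_abs_rpow_le_of_cube {α : Type*} [MeasurableSpace α] {μ : Measure α} {f g : α → ℝ}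
    {c K p q : ℝ} (hc : 0 ≤ c) (hK : 1 ≤ K) (hq : 1 ≤ q) (hpq : p * q = 3) (hg : ∀ x, 0 ≤ g x)
    (hgi : Integrable (fun x ↦ g x ^ 3) μ) (hgK : ∫ x, g x ^ 3 ∂μ ≤ K)
    (hfg : ∀ x, |f x| ≤ c * g x ^ p) :
    (∫ x, |f x| ^ q ∂μ) ^ (1 / q) ≤ c * K := by
  have hq0 : 0 < q := by linarith
  have hle (x : α) : |f x| ^ q ≤ c ^ q * g x ^ 3 := by
    calc |f x| ^ q ≤ (c * g x ^ p) ^ q := by gcongr; exact hfg x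
      _ = c ^ q * g x ^ 3 := by
          rw [Real.mul_rpow hc (Real.rpow_nonneg (hg x) _), ← Real.rpow_mul (hg x), hpq]
          norm_cast
  have hint : ∫ x, |f x| ^ q ∂μ ≤ c ^ q * K := by
    calc _ ≤ ∫ x, c ^ q * g x ^ 3 ∂μ := integral_mono_of_nonneg
            (.of_forall fun x ↦ by positivity) (hgi.const_mul _) (.of_forall hle)
      _ = c ^ q * ∫ x, g x ^ 3 ∂μ := integral_const_mul _ _
      _ ≤ _ := by gcongr
  calc _ ≤ (c ^ q * K) ^ (1 / q) := by
        gcongr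
    _ = c * K ^ (1 / q) := by
        rw [Real.mul_rpow (by positivity) (by linarith), ← Real.rpow_mul hc,
          mul_one_div_cancel hq0.ne', Real.rpow_one]
    _ ≤ c * K := by
        gcongr
        exact Real.rpow_le_self_of_one_le hK ((div_le_one hq0).2 hq)

theorem stmt14 (A : ℝ) (hA : 1 ≤ A) :
    ∃ C > 0, ∃ τ₀ ∈ Set.Ioo (0 : ℝ) 1, ∀ τ ∈ Set.Ioo (0 : ℝ) τ₀, ∀ P : S3, ∀ t : ℝ,
      A⁻¹ * τ ^ (-(1 : ℝ) / 2) < t → t < A * τ ^ (-(1 : ℝ) / 2) →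
      (∫ x, |(bubble P t x) ^ ((2 : ℝ) - τ) - (bubble P t x) ^ 2| ^ ((3 : ℝ) / 2) ∂μS3) ^
          ((2 : ℝ) / 3) ≤ C * τ * |Real.log τ| ∧
      (∫ x, |(bubble P t x) ^ ((1 : ℝ) - τ) - bubble P t x| ^ (3 : ℝ) ∂μS3) ^
          ((1 : ℝ) / 3) ≤ C * τ * |Real.log τ| := by
  obtain ⟨K, hK1, hK⟩ := exists_integral_bubble_cube_le
  have hA0 : 0 < A := by linarith
  have hA2 : 1 ≤ A ^ 2 := one_le_pow₀ hA
  refine ⟨2 * K, by linarith, 1 / (2 * A ^ 2), ⟨by positivity, ?_⟩, ?_⟩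
  · rw [div_lt_one (by positivity)]; linarith
  rintro τ ⟨hτ0, hτ⟩ P t htl htu
  rw [lt_div_iff₀ (by positivity)] at hτ
  have hw0 : 0 < τ ^ (-(1 : ℝ) / 2) := by positivity
  have hw2 : (τ ^ (-(1 : ℝ) / 2)) ^ 2 = τ⁻¹ := by
    rw [← Real.rpow_natCast, ← Real.rpow_mul hτ0.le, ← Real.rpow_neg_one]; norm_num
  set w := τ ^ (-(1 : ℝ) / 2)
  have hτ1 : τ < 1 := by nlinarith
  have ht0 : 0 < t := lt_trans (by positivity) htl
  have ht2 : 2 ≤ t ^ 2 := by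
    have hwt : w < A * t := by rwa [inv_mul_lt_iff₀ hA0] at htl
    have hwt2 : τ⁻¹ < (A * t) ^ 2 := by rw [← hw2]; gcongr
    rw [inv_lt_iff_one_lt_mul₀ hτ0] at hwt2
    by_contra! h
    nlinarith [mul_pos hτ0 (pow_pos hA0 2)]
  have ht1 : 1 ≤ t := by nlinarith
  have htτ : t ≤ τ⁻¹ := by
    refine le_of_pow_le_pow_left₀ (n := 2) (by norm_num) (by positivity) ?_
    calc t ^ 2 ≤ (A * w) ^ 2 := by gcongr
      _ = A ^ 2 * τ⁻¹ := by rw [mul_pow, hw2]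
      _ ≤ τ⁻¹ * τ⁻¹ := by
          gcongr
          rw [le_inv_comm₀ (by positivity) hτ0, ← one_div, le_div_iff₀ (by positivity)]
          nlinarith
      _ = τ⁻¹ ^ 2 := by ring
  have hL : |Real.log τ| = Real.log τ⁻¹ := by
    rw [Real.log_inv, abs_of_neg (Real.log_neg hτ0 hτ1)]
  have hlog (x : S3) : |Real.log (bubble P t x)| ≤ |Real.log τ| := by
    rw [hL]
    have hb := bubble_pos ht1 P x
    have h1 := Real.log_le_log hb ((bubble_le ht1 P x).trans htτ)
    have h2 := Real.log_le_log (inv_pos.2 ht0) (inv_le_bubble ht1 P x)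
    have h3 := Real.log_le_log ht0 htτ
    rw [Real.log_inv t] at h2
    exact abs_le.2 ⟨by linarith, h1⟩
  have hτL : τ * |Real.log τ| ≤ 1 := by
    have := Real.log_le_self (inv_pos.2 hτ0).le
    calc τ * |Real.log τ| ≤ τ * τ⁻¹ := by rw [hL]; gcongr
      _ = 1 := mul_inv_cancel₀ hτ0.ne'
  have key (x : S3) (p : ℝ) := abs_rpow_sub_rpow_le (bubble_pos ht1 P x) hτ0.le (hlog x) hτL p
  have hC : 2 * K * τ * |Real.log τ| = 2 * (τ * |Real.log τ|) * K := by ring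
  rw [hC]
  have hg (x : S3) := (bubble_pos ht1 P x).le
  have hgi := integrable_bubble_pow ht1 P 3
  constructor
  · have h := integral_abs_rpow_le_of_cube (p := 2) (q := 3 / 2) (by positivity) hK1 (by norm_num)
      (by norm_num) hg hgi (hK t ht1 ht2 P) (fun x ↦ key x 2)
    simpa [Real.rpow_two] using h
  · have h := integral_abs_rpow_le_of_cube (p := 1) (q := 3) (by positivity) hK1 (by norm_num)
      (by norm_num) hg hgi (hK t ht1 ht2 P) (fun x ↦ key x 1)
    simpa only [Real.rpow_one] using h
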